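/- Let φ = ∑_{i=1}^h cᵢxᵢ have property N, let X be an infinite subset of a vector space V over F, and let B be a finite subset of X. Then there exists b ∈ X such that the sets Φ_J(B,b), for all subsets J of {1,…,h}, are pairwise disjoint. -/

import Mathlib

open Finset

variable {F : Type*} [Field F] {V : Type*} [AddCommGroup V] [Module F V]

/-- The linear form with coefficients `c` has property N: there do not exist disjoint
subsets `I₁`, `I₂` of `{1,…,h}`, not both empty, with equal coefficient subset sums. -/
def PropN {h : ℕ} (c : Fin h → F) : Prop :=
  ¬ ∃ I₁ I₂ : Finset (Fin h), Disjoint I₁ I₂ ∧ ¬(I₁ = ∅ ∧ I₂ = ∅) ∧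
      ∑ i ∈ I₁, c i = ∑ i ∈ I₂, c i

/-- `A` is a Sidon set for the linear form `φ = ∑ cᵢ xᵢ`. -/
def IsSidonSet {h : ℕ} (c : Fin h → F) (A : Set V) : Prop :=
  A.Nonempty ∧ ∀ a a' : Fin h → V, (∀ i, a i ∈ A) → (∀ i, a' i ∈ A) →
    ∑ i, c i • a i = ∑ i, c i • a' i → a = a'

/-- `Φ_J(A,b) = φ_J(A) + (∑_{j ∈ Jᶜ} c_j) • b`. -/
def PhiJ {h : ℕ} (c : Fin h → F) (J : Finset (Fin h)) (A : Set V) (b : V) : Set V :=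
  {w | ∃ f : Fin h → V, (∀ j ∈ J, f j ∈ A) ∧
    w = (∑ j ∈ J, c j • f j) + (∑ j ∈ Jᶜ, c j) • b}

theorem PropN.sum_compl_injective {h : ℕ} {c : Fin h → F} (hN : PropN c) :
    Function.Injective fun J : Finset (Fin h) => ∑ j ∈ Jᶜ, c j := by
  intro J₁ J₂ hJ
  by_contra hne
  refine hN ⟨J₁ᶜ \ J₂ᶜ, J₂ᶜ \ J₁ᶜ, disjoint_sdiff_sdiff, ?_, ?_⟩
  · rintro ⟨h₁, h₂⟩
    rw [sdiff_eq_empty_iff_subset] at h₁ h₂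
    exact hne (compl_injective (h₁.antisymm h₂))
  · exact sum_sdiff_eq_sum_sdiff_iff.2 hJ

theorem finite_PhiJ {h : ℕ} (c : Fin h → F) (J : Finset (Fin h)) {A : Set V}
    (hA : A.Finite) (b : V) : (PhiJ c J A b).Finite := by
  refine ((Set.Finite.pi' fun _ : Fin h => hA.insert 0).image fun f =>
    (∑ j ∈ J, c j • f j) + (∑ j ∈ Jᶜ, c j) • b).subset ?_
  rintro _ ⟨f, hf, rfl⟩
  refine ⟨fun j => if j ∈ J then f j else 0, fun j => ?_, ?_⟩
  · by_cases hj : j ∈ J <;> simp [hj, hf]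
  · exact congrArg (· + _) (sum_congr rfl fun j hj => by simp [hj])

theorem sub_smul_mem_PhiJ_zero {h : ℕ} {c : Fin h → F} {J : Finset (Fin h)} {A : Set V}
    {b w : V} (hw : w ∈ PhiJ c J A b) : w - (∑ j ∈ Jᶜ, c j) • b ∈ PhiJ c J A 0 := by
  obtain ⟨f, hf, rfl⟩ := hw
  exact ⟨f, hf, by simp⟩

theorem exists_b_PhiJ_pairwise_disjoint {h : ℕ} (c : Fin h → F) (hN : PropN c)
    (X : Set V) (hX : X.Infinite) (B : Set V) (hB : B.Finite) (hBX : B ⊆ X) :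
    ∃ b ∈ X, ∀ J₁ J₂ : Finset (Fin h), J₁ ≠ J₂ →
      Disjoint (PhiJ c J₁ B b) (PhiJ c J₂ B b) := by
  let bad : Set V := ⋃ (J₁ : Finset (Fin h)) (J₂ : Finset (Fin h)),
    Set.image2 (fun v₁ v₂ => (∑ j ∈ J₁ᶜ, c j - ∑ j ∈ J₂ᶜ, c j)⁻¹ • (v₂ - v₁))
      (PhiJ c J₁ B 0) (PhiJ c J₂ B 0)
  have hbad : bad.Finite := Set.finite_iUnion fun J₁ => Set.finite_iUnion fun J₂ =>
    (finite_PhiJ c J₁ hB 0).image2 _ (finite_PhiJ c J₂ hB 0)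
  obtain ⟨b, hbX, hb⟩ := hX.exists_notMem_finite hbad
  refine ⟨b, hbX, fun J₁ J₂ hne => Set.disjoint_left.2 fun w h₁ h₂ => hb ?_⟩
  have hs : ∑ j ∈ J₁ᶜ, c j - ∑ j ∈ J₂ᶜ, c j ≠ 0 :=
    sub_ne_zero.2 (hN.sum_compl_injective.ne hne)
  refine Set.mem_iUnion₂.2 ⟨J₁, J₂, _, sub_smul_mem_PhiJ_zero h₁, _,
    sub_smul_mem_PhiJ_zero h₂, ?_⟩
  beta_reduce
  rw [sub_sub_sub_cancel_left, ← sub_smul, inv_smul_smul₀ hs]
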